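/- arXiv:1302.4234 — 2 statements merged into one kernel-verified Lean document; each statement's English description precedes it below -/
import Mathlib

section
/- Let v_1(x) = x^{3/2}(1 + (5(μ^2-2)/(3(1-μ^2))) x + ((23μ^4 - 38μ^2 + 65)/(12(1-μ^2)^2)) x^2 + ...) be the Frobenius solution of ξ'' = r(x)ξ at x = 0 with exponent 3/2. Then the second solution at exponent -1/2 contains a logarithmic term with coefficient proportional to (5 - μ^2); in particular, the local monodromy at x = 0 is non-diagonalizable (has a logarithm) if and only if μ^2 ≠ 5. -/
/-- The polynomial `R(x)` of the normal form of the NVE, with `p₀ = 1`. -/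
noncomputable def R1 (μ x : ℝ) : ℝ :=
  (34 * x ^ 2 - 40 * x + 3) * (x + 1) ^ 4
  - 6 * μ ^ 2 * (6 * x ^ 2 - 10 * x + 1) * (x ^ 2 - 1) ^ 2
  + μ ^ 4 * (22 * x ^ 2 - 20 * x + 3) * (x - 1) ^ 4

/-- The rational coefficient `r(x)` of `ξ'' = r ξ`, with `p₀ = 1`. -/
noncomputable def r1 (μ x : ℝ) : ℝ :=
  R1 μ x /
    (4 * x ^ 2 * (x ^ 2 - 1) ^ 2 * ((x + 1) ^ 2 - μ ^ 2 * (x - 1) ^ 2) ^ 2)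

open Filter Topology FormalMultilinearSeries in
theorem HasFPowerSeriesAt.deriv_ofScalars {g : ℝ → ℝ} {c : ℕ → ℝ}
    (hg : HasFPowerSeriesAt g (ofScalars ℝ c) 0) :
    HasFPowerSeriesAt (deriv g) (ofScalars ℝ fun n => (n + 1) * c (n + 1)) 0 := by
  have hc : c = fun n => iteratedDeriv n g 0 / n.factorial := by
    rw [← ofScalars_series_eq_iff ℝ]
    exact hg.eq_formalMultilinearSeries hg.analyticAt.hasFPowerSeriesAt
  convert! hg.analyticAt.deriv.hasFPowerSeriesAt using 2
  funext n
  rw [hc, ← iteratedDeriv_succ']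
  push_cast [Nat.factorial_succ]
  field_simp

open Filter Topology FormalMultilinearSeries in
theorem hasFPowerSeriesAt_ofScalars_iff {g : ℝ → ℝ} {c : ℕ → ℝ} :
    HasFPowerSeriesAt g (ofScalars ℝ c) 0 ↔
      ∀ᶠ x in 𝓝 0, HasSum (fun n => c n * x ^ n) (g x) := by
  simp [hasFPowerSeriesAt_iff, coeff_ofScalars, mul_comm]

/-- The coefficients of the solution of `x g'' + s g' = B g`, `g 0 = 1`, where `B = ∑ bₙ xⁿ`;
a resonant coefficient (`n + s = 0`) is set to zero. -/
noncomputable def frobeniusCoeff (b : ℕ → ℝ) (s : ℝ) : ℕ → ℝ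
  | 0 => 1
  | n + 1 => (∑ k : Fin (n + 1), b (n - k) * frobeniusCoeff b s k) / ((n + 1) * (n + s))

theorem frobeniusCoeff_zero (b : ℕ → ℝ) (s : ℝ) : frobeniusCoeff b s 0 = 1 := by
  rw [frobeniusCoeff]

theorem frobeniusCoeff_succ (b : ℕ → ℝ) (s : ℝ) (n : ℕ) :
    frobeniusCoeff b s (n + 1) =
      (∑ k ∈ Finset.range (n + 1), b (n - k) * frobeniusCoeff b s k) / ((n + 1) * (n + s)) := by
  rw [frobeniusCoeff, Finset.sum_range]

theorem abs_frobeniusCoeff_le {b : ℕ → ℝ} {s C r : ℝ} (hC : 0 < C) (hr : 0 < r)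
    (hb : ∀ n, |b n| ≤ C * r ^ n) (hs : ∀ n : ℕ, n + s = 0 ∨ 1 ≤ |n + s|) (n : ℕ) :
    |frobeniusCoeff b s n| ≤ (r + C) ^ n := by
  induction n using Nat.strong_induction_on with
  | _ n ih =>
  cases n with
  | zero => simp [frobeniusCoeff_zero]
  | succ n =>
    rw [frobeniusCoeff_succ]
    have hsum : |∑ k ∈ Finset.range (n + 1), b (n - k) * frobeniusCoeff b s k|
        ≤ (r + C) ^ (n + 1) := by
      calc _ ≤ ∑ k ∈ Finset.range (n + 1), |b (n - k) * frobeniusCoeff b s k| :=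
            Finset.abs_sum_le_sum_abs _ _
        _ ≤ ∑ k ∈ Finset.range (n + 1), (r + C) ^ k * r ^ (n + 1 - 1 - k) * C := by
            refine Finset.sum_le_sum fun k hk => ?_
            rw [abs_mul, add_tsub_cancel_right]
            calc _ ≤ (C * r ^ (n - k)) * (r + C) ^ k :=
                  mul_le_mul (hb _) (ih k (Finset.mem_range.1 hk)) (abs_nonneg _) (by positivity)
              _ = _ := by ring
        _ = (r + C) ^ (n + 1) - r ^ (n + 1) := by
            rw [← Finset.sum_mul, ← (Commute.all _ _).geom_sum₂_mul, add_sub_cancel_left]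
        _ ≤ _ := by linarith [pow_pos hr (n + 1)]
    rcases hs n with h | h
    · rw [h, mul_zero, div_zero, abs_zero]; positivity
    · rw [abs_div, abs_mul]
      refine (div_le_self (abs_nonneg _) ?_).trans hsum
      rw [abs_of_pos (by positivity : (0 : ℝ) < n + 1)]
      nlinarith [n.cast_nonneg (α := ℝ)]

open Filter Topology FormalMultilinearSeries in
/-- Frobenius existence theorem for `x g'' + s g' = B g`. -/
theorem exists_analyticAt_frobenius {B : ℝ → ℝ} {b : ℕ → ℝ} {s : ℝ}
    (hB : HasFPowerSeriesAt B (ofScalars ℝ b) 0)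
    (hs : ∀ n : ℕ, n + s = 0 ∨ 1 ≤ |n + s|)
    (hres : ∀ n : ℕ, n + s = 0 →
      ∑ k ∈ Finset.range (n + 1), b (n - k) * frobeniusCoeff b s k = 0) :
    ∃ g : ℝ → ℝ, AnalyticAt ℝ g 0 ∧ g 0 = 1 ∧
      ∀ᶠ x in 𝓝 0, x * deriv (deriv g) x + s * deriv g x = B x * g x := by
  obtain ⟨C, r, hC, hr, hCr⟩ := le_mul_pow_of_radius_pos _ hB.radius_pos
  have hb : ∀ n, |b n| ≤ C * r ^ n := fun n => by
    simpa [ofScalars_norm] using hCr n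
  set c := frobeniusCoeff b s with hc
  have hcle : ∀ n, |c n| ≤ (r + C) ^ n := abs_frobeniusCoeff_le hC hr hb hs
  have hrec : ∀ n : ℕ, (n + 1) * (n + s) * c (n + 1) =
      ∑ k ∈ Finset.range (n + 1), b (n - k) * c k := fun n => by
    rw [hc, frobeniusCoeff_succ]
    by_cases h : n + s = 0
    · rw [hres n h]; simp
    · field_simp
  set g : ℝ → ℝ := fun x => ∑' n, c n * x ^ n with hg
  have hg0 : HasFPowerSeriesAt g (ofScalars ℝ c) 0 := by
    rw [hasFPowerSeriesAt_ofScalars_iff]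
    have hnear : ∀ᶠ x : ℝ in 𝓝 0, (r + C) * |x| < 1 := by
      have : ContinuousAt (fun x : ℝ => (r + C) * |x|) 0 := by fun_prop
      exact this.eventually_lt_const (by simp)
    filter_upwards [hnear] with x hx
    refine Summable.hasSum (Summable.of_norm_bounded
      (summable_geometric_of_lt_one (by positivity) hx) fun n => ?_)
    rw [Real.norm_eq_abs, abs_mul, abs_pow, mul_pow]
    gcongr
    exact hcle n
  have hg1 := hg0.deriv_ofScalars
  have hg2 := hg1.deriv_ofScalars
  refine ⟨g, hg0.analyticAt, ?_, ?_⟩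
  · rw [hg]
    simp only
    rw [tsum_eq_single 0 (fun n hn => by simp [hn])]
    simp [hc, frobeniusCoeff_zero]
  · rw [hasFPowerSeriesAt_ofScalars_iff] at hg0 hg1 hg2 hB
    filter_upwards [hg0, hg1, hg2, hB] with x h0 h1 h2 hB
    have hprod : HasSum (fun n => ∑ k ∈ Finset.range (n + 1), b (n - k) * c k * x ^ n)
        (B x * g x) := by
      have := (summable_norm_sum_mul_antidiagonal_of_summable_norm h0.summable.norm
        hB.summable.norm).of_norm.hasSum
      rw [← tsum_mul_tsum_eq_tsum_sum_antidiagonal_of_summable_norm h0.summable.norm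
        hB.summable.norm, h0.tsum_eq, hB.tsum_eq, mul_comm] at this
      convert! this using 2 with n
      rw [Finset.Nat.sum_antidiagonal_eq_sum_range_succ_mk]
      refine Finset.sum_congr rfl fun k hk => ?_
      have : x ^ n = x ^ k * x ^ (n - k) := by
        rw [← pow_add, Nat.add_sub_cancel' (Nat.lt_succ_iff.1 (Finset.mem_range.1 hk))]
      simp only [this]
      ring
    have hx2 : HasSum (fun n : ℕ => n * (n + 1) * c (n + 1) * x ^ n)
        (x * deriv (deriv g) x) := by
      rw [← hasSum_nat_add_iff' 1]
      simp only [Finset.sum_range_one, Nat.cast_zero, zero_mul, sub_zero]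
      convert! h2.mul_left x using 2 with n
      push_cast
      ring
    refine (hx2.add (h1.mul_left s)).unique ?_
    convert! hprod using 2 with n
    rw [← Finset.sum_mul, ← hrec]
    ring

open Filter Topology in
theorem AnalyticAt.eventually_deriv_deriv_rpow_mul {g : ℝ → ℝ} (hg : AnalyticAt ℝ g 0) (ρ : ℝ) :
    ∀ᶠ x in 𝓝[>] (0 : ℝ), deriv (deriv fun t : ℝ => t ^ ρ * g t) x =
      x ^ (ρ - 2) * (x ^ 2 * deriv (deriv g) x + 2 * ρ * x * deriv g x + ρ * (ρ - 1) * g x) := by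
  filter_upwards [self_mem_nhdsWithin,
    nhdsWithin_le_nhds hg.eventually_analyticAt.eventually_nhds] with x hx hgx
  have hfirst : deriv (fun t : ℝ => t ^ ρ * g t) =ᶠ[𝓝 x]
      fun t => ρ * t ^ (ρ - 1) * g t + t ^ ρ * deriv g t := by
    filter_upwards [hgx, lt_mem_nhds hx] with t hgt ht
    exact ((Real.hasDerivAt_rpow_const (Or.inl ht.ne')).mul
      hgt.differentiableAt.hasDerivAt).deriv
  have hg0 := hgx.self_of_nhds.differentiableAt.hasDerivAt
  have hg1 := hgx.self_of_nhds.deriv.differentiableAt.hasDerivAt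
  have hx' : (0 : ℝ) < x := hx
  have hp (q : ℝ) := Real.hasDerivAt_rpow_const (p := q) (Or.inl hx'.ne')
  rw [hfirst.deriv_eq]
  refine (((((hp (ρ - 1)).const_mul ρ).mul hg0).add ((hp ρ).mul hg1))).deriv.trans ?_
  have e1 : x ^ (ρ - 1) = x ^ (ρ - 2) * x := by
    rw [← Real.rpow_add_one hx'.ne']; ring_nf
  have e2 : x ^ ρ = x ^ (ρ - 2) * x ^ 2 := by
    rw [← Real.rpow_add_natCast hx'.ne']; norm_num
  have e3 : x ^ (ρ - 1 - 1) = x ^ (ρ - 2) := by ring_nf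
  rw [e1, e2, e3]
  ring

open Filter Topology in
theorem AnalyticAt.eventually_frobenius_iff {g r B : ℝ → ℝ} (hg : AnalyticAt ℝ g 0) (ρ : ℝ)
    (hr : ∀ᶠ x in 𝓝[>] (0 : ℝ), x ^ 2 * r x = ρ * (ρ - 1) + x * B x) :
    ∀ᶠ x in 𝓝[>] (0 : ℝ),
      (deriv (deriv fun t : ℝ => t ^ ρ * g t) x = r x * (x ^ ρ * g x) ↔
        x * deriv (deriv g) x + 2 * ρ * deriv g x = B x * g x) := by
  filter_upwards [hg.eventually_deriv_deriv_rpow_mul ρ, hr, self_mem_nhdsWithin] with x h hr hx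
  have hx' : (0 : ℝ) < x := hx
  have e : x ^ ρ = x ^ (ρ - 2) * x ^ 2 := by
    rw [← Real.rpow_add_natCast hx'.ne']; norm_num
  have hrhs : r x * (x ^ ρ * g x) = x ^ (ρ - 2) * ((ρ * (ρ - 1) + x * B x) * g x) := by
    rw [e, ← hr]; ring
  rw [h, hrhs, mul_right_inj' (Real.rpow_pos_of_pos hx' _).ne']
  refine ⟨fun h => mul_left_cancel₀ hx'.ne' ?_, fun h => ?_⟩
  · linear_combination h
  · linear_combination x * h

theorem eventually_nhdsGT_iff_exists_Ioo {p : ℝ → Prop} :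
    (∀ᶠ x in nhdsWithin (0 : ℝ) (Set.Ioi 0), p x) ↔ ∃ ε > 0, ∀ x ∈ Set.Ioo (0 : ℝ) ε, p x :=
  mem_nhdsGT_iff_exists_Ioo_subset

open Filter Topology in
/-- A solution of exponent `-1/2` without logarithm forces the obstruction to vanish. -/
theorem sq_eq_of_frobenius_solution {g A : ℝ → ℝ} {a : ℝ} (hg : AnalyticAt ℝ g 0) (hg0 : g 0 ≠ 0)
    (hA : ContinuousAt A 0)
    (h : ∀ᶠ x in 𝓝[>] (0 : ℝ), x * deriv (deriv g) x - deriv g x = (a + x * A x) * g x) :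
    A 0 = a ^ 2 := by
  have c0 := hg.continuousAt
  have c1 := hg.deriv.continuousAt
  have c2 := hg.deriv.deriv.continuousAt
  have h1 : -deriv g 0 = a * g 0 := by
    have hl : Tendsto (fun x => x * deriv (deriv g) x - deriv g x) (𝓝[>] 0)
        (𝓝 (0 * deriv (deriv g) 0 - deriv g 0)) :=
      ((continuousAt_id.mul c2).sub c1).tendsto.mono_left nhdsWithin_le_nhds
    have hr : Tendsto (fun x => (a + x * A x) * g x) (𝓝[>] 0) (𝓝 ((a + 0 * A 0) * g 0)) :=
      ((continuousAt_const.add (continuousAt_id.mul hA)).mul c0).tendsto.mono_left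
        nhdsWithin_le_nhds
    simpa using tendsto_nhds_unique hl (hr.congr' (h.mono fun _ hx => hx.symm))
  have hd : HasDerivAt (fun x => -deriv g x - a * g x) (-deriv (deriv g) 0 - a * deriv g 0) 0 :=
    hg.deriv.differentiableAt.hasDerivAt.neg.sub (hg.differentiableAt.hasDerivAt.const_mul a)
  have hl : Tendsto (slope (fun x => -deriv g x - a * g x) 0) (𝓝[>] 0)
      (𝓝 (-deriv (deriv g) 0 - a * deriv g 0)) :=
    (hasDerivAt_iff_tendsto_slope.1 hd).mono_left (nhdsWithin_mono _ fun _ hx => ne_of_gt hx)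
  have hr : Tendsto (fun x => A x * g x - deriv (deriv g) x) (𝓝[>] 0)
      (𝓝 (A 0 * g 0 - deriv (deriv g) 0)) :=
    ((hA.mul c0).sub c2).tendsto.mono_left nhdsWithin_le_nhds
  have hlim := tendsto_nhds_unique hl (hr.congr' (by
    filter_upwards [h, self_mem_nhdsWithin] with x hx hpos
    have hpos' : (0 : ℝ) < x := hpos
    rw [slope_def_field, eq_div_iff (by simpa using hpos'.ne')]
    linear_combination h1 - hx))
  refine mul_right_cancel₀ hg0 ?_
  linear_combination a * h1 - hlim

open Filter Topology in
/-- The expansion `x² r(x) = 3/4 + a₁ x + a₂ x² + …` at `x = 0`. -/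
theorem exists_expansion_r1 {μ : ℝ} (hμ1 : μ ^ 2 ≠ 1) :
    ∃ A : ℝ → ℝ, AnalyticAt ℝ A 0 ∧
      A 0 = (10 + 8 * μ ^ 2 + 7 * μ ^ 4) / (1 - μ ^ 2) ^ 2 ∧
      ∀ᶠ x in 𝓝[>] (0 : ℝ), x ^ 2 * r1 μ x =
        3 / 4 + x * (5 * (μ ^ 2 - 2) / (1 - μ ^ 2) + x * A x) := by
  have hm : 1 - μ ^ 2 ≠ 0 := sub_ne_zero.2 hμ1.symm
  have hD0 : 4 * (1 - μ ^ 2) * (((0 : ℝ) ^ 2 - 1) ^ 2 *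
      ((0 + 1) ^ 2 - μ ^ 2 * (0 - 1) ^ 2) ^ 2) ≠ 0 := by
    norm_num
    exact hm
  refine ⟨fun x =>
    (40 - 8 * μ ^ 2 - 4 * μ ^ 4 - 28 * μ ^ 6 + (80 + 200 * μ ^ 2 - 112 * μ ^ 4 + 152 * μ ^ 6) * x
      + (-83 + 105 * μ ^ 2 + 303 * μ ^ 4 - 325 * μ ^ 6) * x ^ 2
      + (-292 - 328 * μ ^ 2 - 340 * μ ^ 4 + 320 * μ ^ 6) * x ^ 3
      + (-138 - 2 * μ ^ 2 + 230 * μ ^ 4 - 90 * μ ^ 6) * x ^ 4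
      + (148 + 252 * μ ^ 2 + 12 * μ ^ 4 - 92 * μ ^ 6) * x ^ 5
      + (157 - 71 * μ ^ 2 - 169 * μ ^ 4 + 83 * μ ^ 6) * x ^ 6
      + (40 - 100 * μ ^ 2 + 80 * μ ^ 4 - 20 * μ ^ 6) * x ^ 7) /
      (4 * (1 - μ ^ 2) * ((x ^ 2 - 1) ^ 2 * ((x + 1) ^ 2 - μ ^ 2 * (x - 1) ^ 2) ^ 2)),
    ?_, ?_, ?_⟩
  · exact AnalyticAt.div (by fun_prop) (by fun_prop) hD0
  · simp only
    rw [div_eq_div_iff hD0 (pow_ne_zero 2 hm)]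
    ring
  · have hD : ContinuousAt (fun x : ℝ => 4 * (1 - μ ^ 2) * ((x ^ 2 - 1) ^ 2 *
        ((x + 1) ^ 2 - μ ^ 2 * (x - 1) ^ 2) ^ 2)) 0 := by fun_prop
    filter_upwards [self_mem_nhdsWithin, nhdsWithin_le_nhds (hD.eventually_ne hD0)] with x hx hne
    have hx' : x ≠ 0 := ne_of_gt hx
    simp only [ne_eq, mul_eq_zero, pow_eq_zero_iff, OfNat.ofNat_ne_zero, not_false_eq_true,
      not_or] at hne
    obtain ⟨-, h1, h2⟩ := hne
    rw [r1, R1]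
    field_simp
    ring

/-- At `x = 0` the equation `ξ'' = r(x) ξ` always has the Frobenius solution
`v₁(x) = x^{3/2}(1 + (5(μ²-2)/(3(1-μ²))) x + …)` with exponent `3/2`, and the
second solution with exponent `-1/2` is free of logarithms — equivalently
there exist two pure Frobenius solutions `x^{3/2} g₁(x)`, `x^{-1/2} g₂(x)`
with `gᵢ` analytic, `gᵢ(0) ≠ 0` — if and only if `μ² = 5`; i.e. the local
monodromy at `x = 0` has a logarithm iff `μ² ≠ 5`. -/
theorem stmt12 (μ : ℝ) (hμ0 : μ ≠ 0) (hμ1 : μ ^ 2 ≠ 1) :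
    (∃ ε > (0 : ℝ), ∃ g1 : ℝ → ℝ, AnalyticAt ℝ g1 0 ∧ g1 0 = 1 ∧
      deriv g1 0 = 5 * (μ ^ 2 - 2) / (3 * (1 - μ ^ 2)) ∧
      ∀ x ∈ Set.Ioo (0 : ℝ) ε,
        deriv (deriv (fun t : ℝ => t ^ ((3 : ℝ) / 2) * g1 t)) x
          = r1 μ x * (x ^ ((3 : ℝ) / 2) * g1 x)) ∧
    ((∃ ε > (0 : ℝ), ∃ g1 g2 : ℝ → ℝ,
        AnalyticAt ℝ g1 0 ∧ AnalyticAt ℝ g2 0 ∧ g1 0 ≠ 0 ∧ g2 0 ≠ 0 ∧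
        (∀ x ∈ Set.Ioo (0 : ℝ) ε,
          deriv (deriv (fun t : ℝ => t ^ ((3 : ℝ) / 2) * g1 t)) x
            = r1 μ x * (x ^ ((3 : ℝ) / 2) * g1 x)) ∧
        (∀ x ∈ Set.Ioo (0 : ℝ) ε,
          deriv (deriv (fun t : ℝ => t ^ (-(1 : ℝ) / 2) * g2 t)) x
            = r1 μ x * (x ^ (-(1 : ℝ) / 2) * g2 x))) ↔
      μ ^ 2 = 5) := by
  have hm : 1 - μ ^ 2 ≠ 0 := sub_ne_zero.2 hμ1.symm
  obtain ⟨A, hA, hA0, hr⟩ := exists_expansion_r1 hμ1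
  set a := 5 * (μ ^ 2 - 2) / (1 - μ ^ 2) with ha
  have hobs : A 0 = a ^ 2 ↔ μ ^ 2 = 5 := by
    rw [hA0, ha, div_pow, div_left_inj' (pow_ne_zero 2 hm)]
    constructor
    · intro h
      refine mul_left_cancel₀ hm ?_
      linear_combination h / 18
    · intro h
      linear_combination (-18 * (μ ^ 2 - 1)) * h
  have hBan : AnalyticAt ℝ (fun x => a + x * A x) 0 := by fun_prop
  have hB := hBan.hasFPowerSeriesAt
  have hderivB : deriv (fun x => a + x * A x) 0 = A 0 := by
    have := ((hasDerivAt_id (0 : ℝ)).mul hA.differentiableAt.hasDerivAt).const_add a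
    simpa using! this.deriv
  have hr1 : ∀ᶠ x in nhdsWithin (0 : ℝ) (Set.Ioi 0),
      x ^ 2 * r1 μ x = 3 / 2 * (3 / 2 - 1) + x * (a + x * A x) :=
    hr.mono fun x hx => hx.trans (by ring)
  have hr2 : ∀ᶠ x in nhdsWithin (0 : ℝ) (Set.Ioi 0),
      x ^ 2 * r1 μ x = -1 / 2 * (-1 / 2 - 1) + x * (a + x * A x) :=
    hr.mono fun x hx => hx.trans (by ring)
  obtain ⟨g1, hg1, hg10, hode1⟩ := exists_analyticAt_frobenius (s := 3) hB
    (fun n => Or.inr (by rw [abs_of_pos (by positivity)]; linarith [n.cast_nonneg (α := ℝ)]))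
    (fun n hn => by linarith [n.cast_nonneg (α := ℝ)])
  have hsol1 : ∀ᶠ x in nhdsWithin (0 : ℝ) (Set.Ioi 0),
      deriv (deriv (fun t : ℝ => t ^ ((3 : ℝ) / 2) * g1 t)) x
        = r1 μ x * (x ^ ((3 : ℝ) / 2) * g1 x) := by
    filter_upwards [hg1.eventually_frobenius_iff _ hr1, nhdsWithin_le_nhds hode1] with x hx h
    exact hx.2 (by linear_combination h)
  refine ⟨?_, ?_, ?_⟩
  · obtain ⟨ε, hε, h⟩ := eventually_nhdsGT_iff_exists_Ioo.1 hsol1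
    refine ⟨ε, hε, g1, hg1, hg10, ?_, h⟩
    have h0 := hode1.self_of_nhds
    rw [hg10] at h0
    have h3 : deriv g1 0 = a / 3 := by linear_combination h0 / 3
    rw [h3, ha]
    field_simp
  · rintro ⟨ε, hε, -, g2, -, hg2, -, hg20, -, h⟩
    refine hobs.1 (sq_eq_of_frobenius_solution hg2 hg20 hA.continuousAt ?_)
    filter_upwards [hg2.eventually_frobenius_iff _ hr2,
      eventually_nhdsGT_iff_exists_Ioo.2 ⟨ε, hε, h⟩] with x hx h
    linear_combination hx.1 h
  · intro h5
    obtain ⟨g2, hg2, hg20, hode2⟩ := exists_analyticAt_frobenius (s := -1) hB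
      (fun n => by
        rcases n with _ | _ | n
        · right; simp
        · left; simp
        · right
          push_cast
          rw [abs_of_pos] <;> linarith [n.cast_nonneg (α := ℝ)])
      (fun n hn => by
        obtain rfl : n = 1 := by
          have : (n : ℝ) = 1 := by linarith
          exact_mod_cast this
        have := hobs.2 h5
        simp [Finset.sum_range_succ, frobeniusCoeff_succ, frobeniusCoeff_zero, hderivB, this]
        ring)
    have hsol2 : ∀ᶠ x in nhdsWithin (0 : ℝ) (Set.Ioi 0),
        deriv (deriv (fun t : ℝ => t ^ (-(1 : ℝ) / 2) * g2 t)) x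
          = r1 μ x * (x ^ (-(1 : ℝ) / 2) * g2 x) := by
      filter_upwards [hg2.eventually_frobenius_iff _ hr2, nhdsWithin_le_nhds hode2] with x hx h
      exact hx.2 (by linear_combination h)
    obtain ⟨ε, hε, h⟩ := eventually_nhdsGT_iff_exists_Ioo.1 (hsol1.and hsol2)
    exact ⟨ε, hε, g1, g2, hg1, hg2, by simp [hg10], by simp [hg20],
      fun x hx => (h x hx).1, fun x hx => (h x hx).2⟩
end

section
/- If ξ'' = r(x)ξ has a solution of the form ξ = P(x) e^{∫ω dx} with P a nonzero polynomial and ω rational (Kovacic case 1), then necessarily the degree d of P equals α_∞^± − Σ_c α_c^{s(c)} for some choice of signs, where α are the characteristic exponents; for the r(x) of the Zipoy-Voorhees NVE with p_0 = 1 and μ ∉ {0, ±1}, every such admissible non-negative integer d leads to an inconsistent polynomial recursion, hence no solution of this form exists. -/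
open Polynomial

/-- The numerator polynomial `R(x)` of `r(x)` with `p₀ = 1`, over `ℂ`. -/
noncomputable def RP (μ : ℂ) : Polynomial ℂ :=
  (34 * X ^ 2 - 40 * X + 3) * (X + 1) ^ 4
  - C (6 * μ ^ 2) * (6 * X ^ 2 - 10 * X + 1) * (X ^ 2 - 1) ^ 2
  + C (μ ^ 4) * (22 * X ^ 2 - 20 * X + 3) * (X - 1) ^ 4

/-- The polynomial `D₀(x)` with `4 D₀` the denominator of `r(x)`, `p₀ = 1`. -/
noncomputable def D0 (μ : ℂ) : Polynomial ℂ :=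
  X ^ 2 * (X ^ 2 - 1) ^ 2 * ((X + 1) ^ 2 - C (μ ^ 2) * (X - 1) ^ 2) ^ 2

/-- The square root `x (x² - 1) ((x + 1)² - μ² (x - 1)²)` of `D0 μ`. -/
noncomputable def poleProd (μ : ℂ) : ℂ[X] :=
  X * (X + 1) * (X - 1) * (C (1 - μ) * X + C (1 + μ)) * (C (1 + μ) * X + C (1 - μ))

/-- The numerator over `poleProd μ` of `∑ e_c / (x - c)`, where `c` runs over the poles of `r`. -/
noncomputable def residueSum (μ : ℂ) (e₀ e₁ e₂ e₃ e₄ : ℂ) : ℂ[X] :=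
  C e₀ * ((X + 1) * (X - 1) * (C (1 - μ) * X + C (1 + μ)) * (C (1 + μ) * X + C (1 - μ)))
  + C e₁ * (X * (X - 1) * (C (1 - μ) * X + C (1 + μ)) * (C (1 + μ) * X + C (1 - μ)))
  + C e₂ * (X * (X + 1) * (C (1 - μ) * X + C (1 + μ)) * (C (1 + μ) * X + C (1 - μ)))
  + C e₃ * (C (1 - μ) * (X * (X + 1) * (X - 1) * (C (1 + μ) * X + C (1 - μ))))
  + C e₄ * (C (1 + μ) * (X * (X + 1) * (X - 1) * (C (1 - μ) * X + C (1 + μ))))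

theorem D0_eq_poleProd_sq (μ : ℂ) : D0 μ = poleProd μ ^ 2 := by
  simp only [D0, poleProd, map_sub, map_add, map_one, map_pow]
  ring

/-- Writing `ω` plus the logarithmic derivative of `P` in lowest terms `A / B` turns the linear
equation into a Riccati equation. -/
theorem exists_coprime_riccati {D R P N M : ℂ[X]} (hP : P ≠ 0) (hM : M ≠ 0)
    (h : D * (M ^ 2 * derivative (derivative P) + 2 * N * M * derivative P
          + (derivative N * M - N * derivative M + N ^ 2) * P) = R * M ^ 2 * P) :
    ∃ A B : ℂ[X], IsCoprime A B ∧ B ≠ 0 ∧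
      D * (derivative A * B - A * derivative B + A ^ 2) = R * B ^ 2 := by
  have hB : P * M ≠ 0 := mul_ne_zero hP hM
  let _ : GCDMonoid ℂ[X] := EuclideanDomain.gcdMonoid ℂ[X]
  obtain ⟨A, B, hA, hB', hu⟩ := extract_gcd (derivative P * M + N * P) (P * M)
  have hcop : IsCoprime A B := (gcd_isUnit_iff A B).mp hu
  set g := GCDMonoid.gcd (derivative P * M + N * P) (P * M)
  have hg : g ≠ 0 := by rintro h0; rw [h0, zero_mul] at hB'; exact hB hB'
  refine ⟨A, B, hcop, ?_, ?_⟩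
  · rintro rfl; rw [mul_zero] at hB'; exact hB hB'
  · apply mul_left_cancel₀ (pow_ne_zero 2 hg)
    have e : g ^ 2 * (derivative A * B - A * derivative B + A ^ 2)
        = derivative (g * A) * (g * B) - (g * A) * derivative (g * B) + (g * A) ^ 2 := by
      simp only [derivative_mul]; ring
    calc g ^ 2 * (D * (derivative A * B - A * derivative B + A ^ 2))
        = D * (g ^ 2 * (derivative A * B - A * derivative B + A ^ 2)) := by ring
      _ = R * (g * B) ^ 2 := by
        rw [e, ← hA, ← hB']
        simp only [derivative_mul, derivative_add]
        linear_combination P * h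
      _ = g ^ 2 * (R * B ^ 2) := by ring

/-- A rational solution `A / B` of the Riccati equation with right-hand side `R / (4 S²)`, where
`R` and `S` are coprime, is the sum of `T / S` and the logarithmic derivative of `Q`. -/
theorem exists_partial_fraction {S R A B : ℂ[X]} (hS : S ≠ 0) (hRS : IsCoprime S R)
    (hAB : IsCoprime A B) (hB : B ≠ 0)
    (h : 4 * S ^ 2 * (derivative A * B - A * derivative B + A ^ 2) = R * B ^ 2) :
    ∃ T Q : ℂ[X], Q ≠ 0 ∧ (∀ c, S.eval c = 0 → Q.eval c ≠ 0) ∧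
      4 * (S ^ 2 * derivative (derivative Q) + 2 * T * S * derivative Q
        + (derivative T * S - T * derivative S + T ^ 2) * Q) = R * Q := by
  have hSB : S ∣ B := by
    rw [← UniqueFactorizationMonoid.pow_dvd_pow_iff_dvd two_ne_zero]
    refine (hRS.pow_left (m := 2)).dvd_of_dvd_mul_left
      ⟨4 * (derivative A * B - A * derivative B + A ^ 2), ?_⟩
    rw [← h]; ring
  obtain ⟨Q, rfl⟩ := hSB
  have hQ : Q ≠ 0 := right_ne_zero_of_mul hB
  have h' : 4 * (derivative A * (S * Q) - A * derivative (S * Q) + A ^ 2) = R * Q ^ 2 := by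
    apply mul_left_cancel₀ (pow_ne_zero 2 hS)
    linear_combination h
  have hQA : Q ∣ A - S * derivative Q := by
    have hcop : IsCoprime Q A := hAB.symm.of_mul_left_right
    refine hcop.dvd_of_dvd_mul_left ?_
    refine ⟨C (1 / 4) * R * Q - derivative A * S + A * derivative S, ?_⟩
    have h4 : (C (1 / 4) : ℂ[X]) * 4 = 1 := by
      rw [show (4 : ℂ[X]) = C 4 from rfl, ← C_mul]; norm_num
    rw [derivative_mul] at h'
    linear_combination C (1 / 4) * h' - (derivative A * (S * Q)
      - A * (derivative S * Q + S * derivative Q) + A ^ 2) * h4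
  obtain ⟨T, hT⟩ := hQA
  have hA : A = T * Q + S * derivative Q := by linear_combination hT
  refine ⟨T, Q, hQ, fun c hc hQc => ?_, ?_⟩
  · obtain ⟨a, b, hab⟩ := hAB
    have := congrArg (eval c) hab
    simp [hA, hc, hQc] at this
  · apply mul_left_cancel₀ hQ
    rw [hA] at h'
    simp only [derivative_mul, derivative_add] at h'
    linear_combination h'

/-- A polynomial expressed in the basis `(X + 1)^k (X - 1)^(n - k)` vanishes only if its
coefficients do. -/
theorem coeff_eq_zero_of_mobius_sum_eq_zero {n : ℕ} {w : ℕ → ℂ}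
    (h : ∑ k ∈ Finset.range (n + 1), C (w k) * ((X + 1) ^ k * (X - 1) ^ (n - k)) = 0)
    {k : ℕ} (hk : k ≤ n) : w k = 0 := by
  have hp : (∑ k ∈ Finset.range (n + 1), C (w k) * X ^ k : ℂ[X]) = 0 := by
    apply Polynomial.eq_zero_of_infinite_isRoot
    refine (Set.Finite.infinite_compl (Set.finite_singleton (1 : ℂ))).mono fun z hz => ?_
    have hz : z - 1 ≠ 0 := sub_ne_zero.mpr hz
    have := congrArg (eval ((z + 1) / (z - 1))) h
    simp only [eval_finsetSum, eval_mul, eval_C, eval_pow, eval_add, eval_sub, eval_X,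
      eval_one, eval_zero] at this
    have e : ∀ k ∈ Finset.range (n + 1), w k * (((z + 1) / (z - 1) + 1) ^ k *
        ((z + 1) / (z - 1) - 1) ^ (n - k)) = w k * z ^ k * (2 / (z - 1)) ^ n := by
      intro k hk
      have hk : k ≤ n := by simpa [Nat.lt_succ_iff] using hk
      rw [show (z + 1) / (z - 1) + 1 = z * (2 / (z - 1)) by field_simp; ring,
        show (z + 1) / (z - 1) - 1 = 2 / (z - 1) by field_simp; ring, mul_pow]
      rw [mul_assoc (z ^ k), ← pow_add, mul_assoc (w k), Nat.add_sub_cancel' hk]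
    rw [Finset.sum_congr rfl e, ← Finset.sum_mul] at this
    have h2 : (2 / (z - 1)) ^ n ≠ 0 := pow_ne_zero _ (div_ne_zero two_ne_zero hz)
    simpa [IsRoot, eval_finsetSum] using (mul_eq_zero.mp this).resolve_right h2
  have := congrArg (fun p => coeff p k) hp
  simpa [finsetSum_coeff, coeff_C_mul, coeff_X_pow, Nat.lt_succ_iff, hk] using this

theorem exists_mobius_sum {n : ℕ} {Q : ℂ[X]} (hQ : Q.natDegree ≤ n) :
    ∃ w : ℕ → ℂ, Q = ∑ k ∈ Finset.range (n + 1), C (w k) * ((X + 1) ^ k * (X - 1) ^ (n - k)) := by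
  induction n generalizing Q with
  | zero =>
    refine ⟨fun _ => Q.coeff 0, ?_⟩
    simpa using eq_C_of_natDegree_le_zero hQ
  | succ n ih =>
    set c := Q.eval (-1) / (-2) ^ (n + 1)
    have hroot : (X - C (-1)) ∣ Q - C c * (X - 1) ^ (n + 1) := by
      rw [dvd_iff_isRoot, IsRoot, eval_sub, eval_mul, eval_C, eval_pow, eval_sub, eval_X, eval_one,
        show (-1 - 1 : ℂ) = -2 by norm_num, div_mul_cancel₀ _ (pow_ne_zero _ (by norm_num)), sub_self]
    obtain ⟨P, hP⟩ := hroot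
    have hdeg : P.natDegree ≤ n := by
      by_cases h0 : P = 0
      · simp [h0]
      have h1 : (Q - C c * (X - 1) ^ (n + 1)).natDegree ≤ n + 1 := by
        refine (natDegree_sub_le_of_le hQ ?_).trans (max_self _).le
        compute_degree
      rw [hP, natDegree_mul (X_sub_C_ne_zero _) h0, natDegree_X_sub_C] at h1
      omega
    obtain ⟨w, hw⟩ := ih hdeg
    refine ⟨fun k => if k = 0 then c else w (k - 1), ?_⟩
    have hQP : Q = (X + 1) * P + C c * (X - 1) ^ (n + 1) := by
      rw [C_neg, C_1] at hP
      linear_combination hP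
    rw [Finset.sum_range_succ', hQP]
    nth_rw 1 [hw]
    rw [Finset.mul_sum]
    congr 1
    · refine Finset.sum_congr rfl fun k _ => ?_
      simp only [Nat.add_eq_zero_iff, one_ne_zero, and_false, if_false, Nat.add_sub_cancel,
        Nat.add_sub_add_right]
      ring
    · simp

theorem coeff_X_mul_derivative (p : ℂ[X]) (n : ℕ) :
    (X * derivative p).coeff n = n * p.coeff n := by
  cases n with
  | zero => simp
  | succ n => rw [coeff_X_mul, coeff_derivative]; push_cast; ring

theorem natDegree_X_mul_derivative_le {p : ℂ[X]} {n : ℕ} (hp : p.natDegree ≤ n) :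
    (X * derivative p).natDegree ≤ n := by
  rw [natDegree_le_iff_coeff_eq_zero] at *
  intro N hN
  rw [coeff_X_mul_derivative, hp N hN, mul_zero]

/-- The indicial equation at infinity. -/
theorem indicial_infinity {S T R Q : ℂ[X]} {t : ℕ} (hQ : Q ≠ 0)
    (hS : S.natDegree ≤ t + 1) (hT : T.natDegree ≤ t) (hR : R.natDegree < 2 * t)
    (h : 4 * (S ^ 2 * derivative (derivative Q) + 2 * T * S * derivative Q
        + (derivative T * S - T * derivative S + T ^ 2) * Q) = R * Q) :
    (S.coeff (t + 1) * Q.natDegree + T.coeff t)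
      * (S.coeff (t + 1) * Q.natDegree + T.coeff t - S.coeff (t + 1)) = 0 := by
  set d := Q.natDegree
  have e : C 4 * (S * S * (X * derivative (X * derivative Q)) - S * S * (X * derivative Q)
      + C 2 * ((X * T) * S * (X * derivative Q))
      + (X * derivative T) * (X * S) * Q - (X * T) * (X * derivative S) * Q
      + (X * T) * (X * T) * Q) = (X ^ 2 * R) * Q := by
    rw [derivative_mul, derivative_X, show (C 4 : ℂ[X]) = 4 from rfl,
      show (C 2 : ℂ[X]) = 2 from rfl]
    linear_combination X ^ 2 * h
  have hQ1 := natDegree_X_mul_derivative_le (le_refl d)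
  have hQ2 := natDegree_X_mul_derivative_le hQ1
  have hS1 := natDegree_X_mul_derivative_le hS
  have hT1 := natDegree_X_mul_derivative_le hT
  have hXT : (X * T).natDegree ≤ t + 1 := by
    rw [add_comm]; exact natDegree_mul_le_of_le natDegree_X_le hT
  have hXS : (X * S).natDegree ≤ t + 2 := by
    rw [show t + 2 = 1 + (t + 1) by ring]; exact natDegree_mul_le_of_le natDegree_X_le hS
  have hR0 : (X ^ 2 * R * Q).coeff ((t + 1) + (t + 1) + d) = 0 := by
    apply coeff_eq_zero_of_natDegree_lt
    have := natDegree_mul_le_of_le (natDegree_mul_le_of_le (natDegree_X_pow_le (R := ℂ) 2)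
      (le_refl R.natDegree)) (le_refl d)
    omega
  have key : ∀ {a b c : ℂ[X]} {i j : ℕ}, a.natDegree ≤ i → b.natDegree ≤ j → c.natDegree ≤ d →
      i + j = (t + 1) + (t + 1) →
      (a * b * c).coeff ((t + 1) + (t + 1) + d) = a.coeff i * b.coeff j * c.coeff d := by
    intro a b c i j ha hb hc hij
    rw [← hij, coeff_mul_add_eq_of_natDegree_le (natDegree_mul_le_of_le ha hb) hc,
      coeff_mul_add_eq_of_natDegree_le ha hb]
  have := congrArg (fun p => coeff p ((t + 1) + (t + 1) + d)) e
  simp only [coeff_C_mul, coeff_add, coeff_sub, hR0, key hS hS hQ2 rfl, key hS hS hQ1 rfl,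
    key hXT hS hQ1 rfl, key hT1 hXS le_rfl (by ring), key hXT hS1 le_rfl rfl,
    key hXT hXT le_rfl rfl] at this
  simp only [coeff_X_mul_derivative, coeff_X_mul, coeff_derivative] at this
  have hq : Q.coeff d ≠ 0 := by simpa [d] using hQ
  apply mul_left_cancel₀ (mul_ne_zero ((by norm_num : (4 : ℂ) ≠ 0)) hq)
  linear_combination this

/-- The indicial equation at a simple zero of `S`. -/
theorem indicial_pole {S T R Q : ℂ[X]} {c e e' : ℂ} (hS : S.eval c = 0) (hQ : Q.eval c ≠ 0)
    (he : e + e' = 4) (hR : 4 * R.eval c = -(e * e') * (derivative S).eval c ^ 2)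
    (h : 4 * (S ^ 2 * derivative (derivative Q) + 2 * T * S * derivative Q
        + (derivative T * S - T * derivative S + T ^ 2) * Q) = R * Q) :
    4 * T.eval c = e * (derivative S).eval c ∨ 4 * T.eval c = e' * (derivative S).eval c := by
  have h' := congrArg (eval c) h
  simp only [eval_mul, eval_add, eval_sub, eval_pow, hS, eval_ofNat] at h'
  rw [← sub_eq_zero, ← sub_eq_zero (a := 4 * T.eval c), ← mul_eq_zero]
  apply mul_left_cancel₀ hQ
  linear_combination 4 * h' + hR * Q.eval c - 4 * he * T.eval c * (derivative S).eval c * Q.eval c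

theorem poleProd_ne_zero {μ : ℂ} (hμ1 : μ ≠ 1) (hμ2 : μ ≠ -1) : poleProd μ ≠ 0 := by
  have h1 : 1 - μ ≠ 0 := sub_ne_zero.mpr hμ1.symm
  have h2 : 1 + μ ≠ 0 := fun h => hμ2 (by linear_combination h)
  have hX1 : (X + 1 : ℂ[X]) ≠ 0 := X_add_C_ne_zero 1
  have hX2 : (X - 1 : ℂ[X]) ≠ 0 := X_sub_C_ne_zero 1
  have hlin : ∀ a b : ℂ, a ≠ 0 → (C a * X + C b : ℂ[X]) ≠ 0 := fun a b ha h => by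
    have := congrArg (fun p => coeff p 1) h
    simp [ha] at this
  unfold poleProd
  exact mul_ne_zero (mul_ne_zero (mul_ne_zero (mul_ne_zero X_ne_zero hX1) hX2) (hlin _ _ h1))
    (hlin _ _ h2)

/-- The equation for `Q` saying that the sum of `U / (4 S)`, with `S = poleProd μ`, and the
logarithmic derivative of `Q` solves the Riccati equation with right-hand side `r`. -/
def KovacicEq (μ : ℂ) (U Q : ℂ[X]) : Prop :=
  16 * poleProd μ ^ 2 * derivative (derivative Q) + 8 * U * poleProd μ * derivative Q
    + (4 * (derivative U * poleProd μ - U * derivative (poleProd μ)) + U ^ 2) * Q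
  = 4 * RP μ * Q

theorem coeff_eq_zero_of_poleProd_mul {μ : ℂ} (hμ1 : μ ≠ 1) (hμ2 : μ ≠ -1) {n : ℕ} {w : ℕ → ℂ}
    (h : poleProd μ *
      ∑ k ∈ Finset.range (n + 1), C (w k) * ((X + 1) ^ k * (X - 1) ^ (n - k)) = 0) :
    ∀ k ≤ n, w k = 0 := fun _ hk =>
  coeff_eq_zero_of_mobius_sum_eq_zero
    ((mul_eq_zero.mp h).resolve_left (poleProd_ne_zero hμ1 hμ2)) hk

theorem eq_zero_of_degree_three {μ : ℂ} (hμ0 : μ ≠ 0) (hμ1 : μ ≠ 1) (hμ2 : μ ≠ -1) {Q : ℂ[X]}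
    (hQ : Q.natDegree ≤ 3) (h : KovacicEq μ (residueSum μ (-2) (-5) 1 (-1) (-1)) Q) : Q = 0 := by
  obtain ⟨w, rfl⟩ := exists_mobius_sum hQ
  have key := coeff_eq_zero_of_poleProd_mul hμ1 hμ2 (n := 4)
    (w := fun k => match k with
      | 0 => 16 * (μ ^ 2 * (-9 * w 0 + 5 * w 1))
      | 1 => 32 * (μ ^ 2 * (-w 1 + 3 * w 2))
      | 2 => 16 * (15 * w 0 - 7 * w 1 + μ ^ 2 * w 2 + 3 * μ ^ 2 * w 3)
      | 3 => 32 * (3 * w 1 - 5 * w 2)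
      | _ => 16 * (w 2 - 9 * w 3)) (by
    simp only [KovacicEq, Finset.sum_range_succ, Finset.sum_range_zero, Nat.reduceSub,
      Nat.sub_zero, Nat.sub_self, pow_zero, pow_one, mul_one, one_mul, zero_add] at h ⊢
    simp only [poleProd, residueSum, RP, derivative_mul, derivative_add, derivative_sub,
      derivative_pow, derivative_X, derivative_C, derivative_one, derivative_zero,
      derivative_neg, derivative_ofNat, Nat.reduceSub, pow_one,
      C_mul, C_add, C_sub, C_neg, C_pow, map_ofNat, C_1, Nat.cast_ofNat] at h ⊢
    linear_combination h)
  have k0 : 16 * (μ ^ 2 * (-9 * w 0 + 5 * w 1)) = 0 := key 0 (by norm_num)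
  have k1 : 32 * (μ ^ 2 * (-w 1 + 3 * w 2)) = 0 := key 1 (by norm_num)
  have k2 : 16 * (15 * w 0 - 7 * w 1 + μ ^ 2 * w 2 + 3 * μ ^ 2 * w 3) = 0 :=
    key 2 (by norm_num)
  have k3 : 32 * (3 * w 1 - 5 * w 2) = 0 := key 3 (by norm_num)
  simp only [mul_eq_zero, pow_eq_zero_iff two_ne_zero, hμ0, OfNat.ofNat_ne_zero, false_or]
    at k0 k1 k2 k3
  have h2 : w 2 = 0 := by linear_combination (1 / 4) * k3 + (3 / 4) * k1
  have h1 : w 1 = 0 := by linear_combination -k1 + 3 * h2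
  have h0 : w 0 = 0 := by linear_combination (-1 / 9) * k0 + (5 / 9) * h1
  have h3 : w 3 = 0 := by simpa [h0, h1, h2, hμ0] using k2
  simp [Finset.sum_range_succ, h0, h1, h2, h3]

theorem eq_zero_of_residue_at_zero {μ : ℂ} (hμ0 : μ ≠ 0) (hμ1 : μ ≠ 1) (hμ2 : μ ≠ -1) {Q : ℂ[X]}
    (hQ : Q.natDegree ≤ 1) (h : KovacicEq μ (residueSum μ 6 (-5) 1 (-1) (-1)) Q) : Q = 0 := by
  obtain ⟨w, rfl⟩ := exists_mobius_sum hQ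
  have key := coeff_eq_zero_of_poleProd_mul hμ1 hμ2 (n := 2)
    (w := fun k => match k with
      | 0 => 16 * (μ ^ 2 * (w 0 + 5 * w 1))
      | 1 => 0
      | _ => 16 * (w 0 - 7 * w 1)) (by
    simp only [KovacicEq, Finset.sum_range_succ, Finset.sum_range_zero, Nat.reduceSub,
      Nat.sub_zero, Nat.sub_self, pow_zero, pow_one, mul_one, one_mul, zero_add] at h ⊢
    simp only [poleProd, residueSum, RP, derivative_mul, derivative_add, derivative_sub,
      derivative_X, derivative_C, derivative_one, derivative_zero,
      derivative_neg, derivative_ofNat,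
      C_mul, C_add, C_sub, C_neg, C_pow, map_ofNat, C_1, C_0] at h ⊢
    linear_combination h)
  have k0 : 16 * (μ ^ 2 * (w 0 + 5 * w 1)) = 0 := key 0 (by norm_num)
  have k2 : 16 * (w 0 - 7 * w 1) = 0 := key 2 (by norm_num)
  simp only [mul_eq_zero, pow_eq_zero_iff two_ne_zero, hμ0, OfNat.ofNat_ne_zero, false_or]
    at k0 k2
  have h1 : w 1 = 0 := by linear_combination (1 / 12) * k0 - (1 / 12) * k2
  have h0 : w 0 = 0 := by linear_combination k2 + 7 * h1
  simp [Finset.sum_range_succ, h0, h1]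

theorem eq_zero_of_residues_at_both {μ : ℂ} (hμ1 : μ ≠ 1) (hμ2 : μ ≠ -1) {Q : ℂ[X]}
    (hQ : Q.natDegree ≤ 0) (h : KovacicEq μ (residueSum μ (-2) (-5) 1 5 5) Q) : Q = 0 := by
  obtain ⟨w, rfl⟩ := exists_mobius_sum hQ
  have key := coeff_eq_zero_of_poleProd_mul hμ1 hμ2 (n := 1)
    (w := fun k => match k with
      | 0 => -144 * (μ ^ 2 * w 0)
      | _ => -144 * w 0) (by
    simp only [KovacicEq, Finset.sum_range_succ, Finset.sum_range_zero,
      Nat.sub_zero, Nat.sub_self, pow_zero, pow_one, mul_one, one_mul, zero_add] at h ⊢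
    simp only [poleProd, residueSum, RP, derivative_mul, derivative_add, derivative_sub,
      derivative_X, derivative_C, derivative_one, derivative_zero,
      derivative_neg, derivative_ofNat,
      C_mul, C_add, C_sub, C_neg, C_pow, map_ofNat, C_1] at h ⊢
    linear_combination h)
  have k1 : -144 * w 0 = 0 := key 1 (by norm_num)
  have h0 : w 0 = 0 := by linear_combination (-1 / 144) * k1
  simp [h0]

theorem eq_zero_of_residue_at_one {μ : ℂ} (hμ0 : μ ≠ 0) (hμ1 : μ ≠ 1) (hμ2 : μ ≠ -1) {Q : ℂ[X]}
    (hQ : Q.natDegree ≤ 1) (h : KovacicEq μ (residueSum μ (-2) (-5) 3 5 (-1)) Q) : Q = 0 := by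
  obtain ⟨w, rfl⟩ := exists_mobius_sum hQ
  have key := coeff_eq_zero_of_poleProd_mul hμ1 hμ2 (n := 2)
    (w := fun k => match k with
      | 0 => 8 * (μ * (-(18 * μ + 15) * w 0 + 10 * μ * w 1))
      | 1 => 8 * (-(4 * μ ^ 2 + 3 * μ) * w 1 - (18 + 21 * μ) * w 0)
      | _ => 8 * (6 * w 0 - (20 + 9 * μ) * w 1)) (by
    simp only [KovacicEq, Finset.sum_range_succ, Finset.sum_range_zero, Nat.reduceSub,
      Nat.sub_zero, Nat.sub_self, pow_zero, pow_one, mul_one, one_mul, zero_add] at h ⊢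
    simp only [poleProd, residueSum, RP, derivative_mul, derivative_add, derivative_sub,
      derivative_X, derivative_C, derivative_one, derivative_zero,
      derivative_neg, derivative_ofNat,
      C_mul, C_add, C_sub, C_neg, C_pow, map_ofNat, C_1] at h ⊢
    linear_combination h)
  have k0 : 8 * (μ * (-(18 * μ + 15) * w 0 + 10 * μ * w 1)) = 0 := key 0 (by norm_num)
  have k1 : 8 * (-(4 * μ ^ 2 + 3 * μ) * w 1 - (18 + 21 * μ) * w 0) = 0 := key 1 (by norm_num)
  have k2 : 8 * (6 * w 0 - (20 + 9 * μ) * w 1) = 0 := key 2 (by norm_num)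
  simp only [mul_eq_zero, hμ0, OfNat.ofNat_ne_zero, false_or] at k0 k1 k2
  have h1 : w 1 = 0 := by
    linear_combination
      (-2 * (2417 / 28290 + 7171 / 339480 * μ)) * (k0 + (18 * μ + 15) / 6 * k2)
      - 2 * (-21341 / 339480 - 303 / 18860 * μ) * (k1 + (18 + 21 * μ) / 6 * k2)
  have h0 : w 0 = 0 := by linear_combination (1 / 6) * k2 + (20 + 9 * μ) / 6 * h1
  simp [Finset.sum_range_succ, h0, h1]

theorem poleProd_neg (μ : ℂ) : poleProd (-μ) = poleProd μ := by
  simp only [poleProd, C_sub, C_add, C_neg]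
  ring

theorem RP_neg (μ : ℂ) : RP (-μ) = RP μ := by
  simp only [RP, even_two.neg_pow, (by decide : Even 4).neg_pow]

theorem residueSum_neg (μ e₀ e₁ e₂ e₃ e₄ : ℂ) :
    residueSum (-μ) e₀ e₁ e₂ e₃ e₄ = residueSum μ e₀ e₁ e₂ e₄ e₃ := by
  simp only [residueSum, C_sub, C_add, C_neg]
  ring

theorem natDegree_poleProd_le (μ : ℂ) : (poleProd μ).natDegree ≤ 5 := by
  unfold poleProd; compute_degree

theorem coeff_poleProd_five (μ : ℂ) : (poleProd μ).coeff 5 = (1 - μ) * (1 + μ) := by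
  unfold poleProd
  compute_degree
  all_goals norm_num

theorem natDegree_RP_le (μ : ℂ) : (RP μ).natDegree ≤ 6 := by
  unfold RP; compute_degree

theorem natDegree_residueSum_le (μ e₀ e₁ e₂ e₃ e₄ : ℂ) :
    (residueSum μ e₀ e₁ e₂ e₃ e₄).natDegree ≤ 4 := by
  unfold residueSum; compute_degree

theorem coeff_residueSum_four (μ e₀ e₁ e₂ e₃ e₄ : ℂ) :
    (residueSum μ e₀ e₁ e₂ e₃ e₄).coeff 4
      = (e₀ + e₁ + e₂ + e₃ + e₄) * ((1 - μ) * (1 + μ)) := by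
  unfold residueSum
  compute_degree
  · ring
  all_goals norm_num

/-- The poles of `r`. -/
noncomputable def pole (μ : ℂ) : Fin 5 → ℂ :=
  ![0, -1, 1, (μ + 1) / (μ - 1), (μ - 1) / (μ + 1)]

theorem pole_injective {μ : ℂ} (hμ0 : μ ≠ 0) (hμ1 : μ ≠ 1) (hμ2 : μ ≠ -1) :
    Function.Injective (pole μ) := by
  have h1 : μ - 1 ≠ 0 := sub_ne_zero.mpr hμ1
  have h2 : μ + 1 ≠ 0 := fun h => hμ2 (by linear_combination h)
  have h02 : (0 : ℂ) ≠ 2 := two_ne_zero.symm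
  have ne₀ : (μ + 1) / (μ - 1) ≠ 0 := div_ne_zero h2 h1
  have ne₁ : (μ + 1) / (μ - 1) ≠ -1 := fun h => hμ0 (by
    rw [div_eq_iff h1] at h; linear_combination h / 2)
  have ne₂ : (μ + 1) / (μ - 1) ≠ 1 := fun h => h02 (by
    rw [div_eq_iff h1] at h; linear_combination -h)
  have ne₃ : (μ - 1) / (μ + 1) ≠ 0 := div_ne_zero h1 h2
  have ne₄ : (μ - 1) / (μ + 1) ≠ -1 := fun h => hμ0 (by
    rw [div_eq_iff h2] at h; linear_combination h / 2)
  have ne₅ : (μ - 1) / (μ + 1) ≠ 1 := fun h => h02 (by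
    rw [div_eq_iff h2] at h; linear_combination h)
  have ne₆ : (μ + 1) / (μ - 1) ≠ (μ - 1) / (μ + 1) := fun h => hμ0 (by
    rw [div_eq_div_iff h1 h2] at h; linear_combination h / 4)
  have ne₇ : (-1 : ℂ) ≠ 1 := by norm_num
  have ne₈ : (-1 : ℂ) ≠ 0 := by norm_num
  have ne₉ : (1 : ℂ) ≠ 0 := one_ne_zero
  rw [← List.nodup_ofFn]
  simp [pole, List.ofFn_succ, ne₀.symm, ne₁.symm, ne₂.symm, ne₃.symm, ne₄.symm, ne₅.symm, ne₆,
    ne₇, ne₈.symm, ne₉.symm]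

theorem eval_poleProd_pole {μ : ℂ} (hμ1 : μ ≠ 1) (hμ2 : μ ≠ -1) (i : Fin 5) :
    (poleProd μ).eval (pole μ i) = 0 := by
  have h1 : μ - 1 ≠ 0 := sub_ne_zero.mpr hμ1
  have h2 : μ + 1 ≠ 0 := fun h => hμ2 (by linear_combination h)
  simp only [poleProd, eval_mul, eval_add, eval_sub, eval_X, eval_C, eval_one]
  fin_cases i
  · simp [pole]
  · simp [pole]
  · simp [pole]
  · apply mul_eq_zero_of_left
    apply mul_eq_zero_of_right
    simp only [pole, Fin.reduceFinMk, Matrix.cons_val]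
    field_simp; ring
  · apply mul_eq_zero_of_right
    simp only [pole, Fin.reduceFinMk, Matrix.cons_val]
    field_simp; ring

theorem exists_pole_eq {μ c : ℂ} (hμ1 : μ ≠ 1) (hμ2 : μ ≠ -1) (hc : (poleProd μ).eval c = 0) :
    ∃ i, pole μ i = c := by
  have h1 : μ - 1 ≠ 0 := sub_ne_zero.mpr hμ1
  have h2 : μ + 1 ≠ 0 := fun h => hμ2 (by linear_combination h)
  simp only [poleProd, eval_mul, eval_add, eval_sub, eval_X, eval_C, eval_one, mul_eq_zero] at hc
  obtain (((hc | hc) | hc) | hc) | hc := hc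
  · exact ⟨0, hc.symm⟩
  · exact ⟨1, by simp only [pole, Matrix.cons_val]; linear_combination -hc⟩
  · exact ⟨2, by simp only [pole, Matrix.cons_val]; linear_combination -hc⟩
  · exact ⟨3, by
      simp only [pole, Matrix.cons_val]; rw [div_eq_iff h1]; linear_combination hc⟩
  · exact ⟨4, by
      simp only [pole, Matrix.cons_val]; rw [div_eq_iff h2]; linear_combination -hc⟩

theorem eval_derivative_poleProd (μ c : ℂ) :
    (derivative (poleProd μ)).eval c
      = 5 * (1 - μ ^ 2) * c ^ 4 + 8 * (1 + μ ^ 2) * c ^ 3 - 4 * (1 + μ ^ 2) * c - (1 - μ ^ 2) := by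
  simp only [poleProd, derivative_mul, derivative_add, derivative_sub, derivative_X, derivative_C,
    derivative_one, eval_mul, eval_add, eval_sub, eval_X, eval_C, eval_one, eval_zero]
  ring

theorem eval_derivative_poleProd_pole_ne_zero {μ : ℂ} (hμ0 : μ ≠ 0) (hμ1 : μ ≠ 1) (hμ2 : μ ≠ -1)
    (i : Fin 5) : (derivative (poleProd μ)).eval (pole μ i) ≠ 0 := by
  have h1 : μ - 1 ≠ 0 := sub_ne_zero.mpr hμ1
  have h2 : μ + 1 ≠ 0 := fun h => hμ2 (by linear_combination h)
  rw [eval_derivative_poleProd]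
  fin_cases i <;> simp only [pole, Fin.reduceFinMk, Fin.zero_eta, Fin.mk_one, Matrix.cons_val]
  · convert mul_ne_zero h1 h2 using 1
    ring
  · convert mul_ne_zero (by norm_num : (-8 : ℂ) ≠ 0) (pow_ne_zero 2 hμ0) using 1
    ring
  · convert (by norm_num : (8 : ℂ) ≠ 0) using 1
    ring
  · convert div_ne_zero (mul_ne_zero (mul_ne_zero (by norm_num : (-16 : ℂ) ≠ 0)
      (pow_ne_zero 2 hμ0)) h2) (pow_ne_zero 3 h1) using 1
    field_simp; ring
  · convert div_ne_zero (mul_ne_zero (mul_ne_zero (by norm_num : (-16 : ℂ) ≠ 0)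
      (pow_ne_zero 2 hμ0)) h1) (pow_ne_zero 3 h2) using 1
    field_simp; ring

/-- At each pole, the larger of the two exponents, multiplied by `4`. -/
def largeExponent : Fin 5 → ℤ := ![6, 9, 3, 5, 5]

theorem eval_RP_pole {μ : ℂ} (hμ1 : μ ≠ 1) (hμ2 : μ ≠ -1) (i : Fin 5) :
    4 * (RP μ).eval (pole μ i) = -((largeExponent i : ℂ) * (4 - largeExponent i)) *
      (derivative (poleProd μ)).eval (pole μ i) ^ 2 := by
  have h1 : μ - 1 ≠ 0 := sub_ne_zero.mpr hμ1
  have h2 : μ + 1 ≠ 0 := fun h => hμ2 (by linear_combination h)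
  rw [eval_derivative_poleProd]
  simp only [RP, eval_mul, eval_add, eval_sub, eval_pow, eval_X, eval_C, eval_one, eval_ofNat]
  fin_cases i <;> simp only [pole, largeExponent, Fin.reduceFinMk, Fin.zero_eta, Fin.mk_one,
    Matrix.cons_val, Int.cast_ofNat]
  · ring
  · ring
  · ring
  · field_simp; ring
  · field_simp; ring

theorem eval_residueSum_pole {μ : ℂ} (hμ1 : μ ≠ 1) (hμ2 : μ ≠ -1) (e : Fin 5 → ℂ) (i : Fin 5) :
    (residueSum μ (e 0) (e 1) (e 2) (e 3) (e 4)).eval (pole μ i)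
      = e i * (derivative (poleProd μ)).eval (pole μ i) := by
  have h1 : μ - 1 ≠ 0 := sub_ne_zero.mpr hμ1
  have h2 : μ + 1 ≠ 0 := fun h => hμ2 (by linear_combination h)
  rw [eval_derivative_poleProd]
  simp only [residueSum, eval_mul, eval_add, eval_sub, eval_X, eval_C, eval_one]
  fin_cases i <;> simp only [pole, Fin.reduceFinMk, Fin.zero_eta, Fin.mk_one, Matrix.cons_val]
  · ring
  · ring
  · ring
  · field_simp; ring
  · field_simp; ring

theorem isCoprime_poleProd_RP {μ : ℂ} (hμ0 : μ ≠ 0) (hμ1 : μ ≠ 1) (hμ2 : μ ≠ -1) :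
    IsCoprime (poleProd μ) (RP μ) := by
  rw [isCoprime_iff_aeval_ne_zero_of_isAlgClosed ℂ ℂ]
  intro c
  rw [or_iff_not_imp_left, not_not]
  intro hc hR
  obtain ⟨i, rfl⟩ := exists_pole_eq hμ1 hμ2 (by simpa using hc)
  have h := eval_RP_pole hμ1 hμ2 i
  rw [show (RP μ).eval (pole μ i) = 0 by simpa using hR, mul_zero, eq_comm, mul_eq_zero,
    or_iff_left (pow_ne_zero 2 (eval_derivative_poleProd_pole_ne_zero hμ0 hμ1 hμ2 i))] at h
  fin_cases i <;> norm_num [largeExponent] at h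

/-- The residues of `T / S`, with `S = poleProd μ`, are characteristic exponents of `r`. -/
theorem exists_residueSum_eq {μ : ℂ} (hμ0 : μ ≠ 0) (hμ1 : μ ≠ 1) (hμ2 : μ ≠ -1) {T Q : ℂ[X]}
    (hT : T.natDegree ≤ 4) (hQ : ∀ c, (poleProd μ).eval c = 0 → Q.eval c ≠ 0)
    (h : 4 * (poleProd μ ^ 2 * derivative (derivative Q) + 2 * T * poleProd μ * derivative Q
      + (derivative T * poleProd μ - T * derivative (poleProd μ) + T ^ 2) * Q) = RP μ * Q) :
    ∃ e : Fin 5 → ℤ, (∀ i, e i = largeExponent i ∨ e i = 4 - largeExponent i) ∧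
      4 * T = residueSum μ (e 0) (e 1) (e 2) (e 3) (e 4) := by
  have hres : ∀ i, ∃ e : ℤ, (e = largeExponent i ∨ e = 4 - largeExponent i) ∧
      4 * T.eval (pole μ i) = e * (derivative (poleProd μ)).eval (pole μ i) := by
    intro i
    have h0 := eval_poleProd_pole hμ1 hμ2 i
    obtain hi | hi := indicial_pole h0 (hQ _ h0) (by ring) (eval_RP_pole hμ1 hμ2 i) h
    · exact ⟨_, Or.inl rfl, hi⟩
    · exact ⟨_, Or.inr rfl, by push_cast; exact hi⟩
  choose e he hTe using hres
  refine ⟨e, he, sub_eq_zero.mp ?_⟩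
  refine eq_zero_of_natDegree_lt_card_of_eval_eq_zero _ (pole_injective hμ0 hμ1 hμ2) (fun i => ?_)
    ?_
  · rw [eval_sub, eval_mul, eval_ofNat, hTe i,
      eval_residueSum_pole hμ1 hμ2 (fun i => (e i : ℂ)) i, sub_self]
  · rw [Fintype.card_fin]
    have h4 : (4 * T).natDegree ≤ 4 := by
      simpa using natDegree_mul_le_of_le (natDegree_ofNat (R := ℂ) 4).le hT
    exact Nat.lt_succ_of_le ((natDegree_sub_le_of_le h4
      (natDegree_residueSum_le _ _ _ _ _ _)).trans (max_self 4).le)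

theorem natDegree_le_four {μ : ℂ} {T Q : ℂ[X]} (hQ : Q ≠ 0)
    (h : 4 * (poleProd μ ^ 2 * derivative (derivative Q) + 2 * T * poleProd μ * derivative Q
      + (derivative T * poleProd μ - T * derivative (poleProd μ) + T ^ 2) * Q) = RP μ * Q) :
    T.natDegree ≤ 4 := by
  by_contra! ht
  have hS := natDegree_poleProd_le μ
  have hR := natDegree_RP_le μ
  have h0 := indicial_infinity hQ (by omega) le_rfl (by omega) h
  rw [coeff_eq_zero_of_natDegree_lt (p := poleProd μ) (by omega)] at h0
  have hT : T = 0 := by simpa using h0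
  simp [hT] at ht

theorem eq_zero_of_kovacicEq {μ : ℂ} (hμ0 : μ ≠ 0) (hμ1 : μ ≠ 1) (hμ2 : μ ≠ -1) {Q : ℂ[X]}
    {e : Fin 5 → ℤ} (he : ∀ i, e i = largeExponent i ∨ e i = 4 - largeExponent i)
    (hd : 4 * (Q.natDegree : ℤ) + (e 0 + e 1 + e 2 + e 3 + e 4) = 0 ∨
      4 * (Q.natDegree : ℤ) + (e 0 + e 1 + e 2 + e 3 + e 4) = 4)
    (h : KovacicEq μ (residueSum μ (e 0) (e 1) (e 2) (e 3) (e 4)) Q) : Q = 0 := by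
  have h0 : e 0 = 6 ∨ e 0 = -2 := he 0
  have h1 : e 1 = 9 ∨ e 1 = -5 := he 1
  have h2 : e 2 = 3 ∨ e 2 = 1 := he 2
  have h3 : e 3 = 5 ∨ e 3 = -1 := he 3
  have h4 : e 4 = 5 ∨ e 4 = -1 := he 4
  rcases h0 with h0 | h0 <;> rcases h1 with h1 | h1 <;> rcases h2 with h2 | h2 <;>
    rcases h3 with h3 | h3 <;> rcases h4 with h4 | h4 <;>
    simp only [h0, h1, h2, h3, h4] at h hd <;> try omega
  all_goals push_cast at h
  · exact eq_zero_of_residue_at_zero hμ0 hμ1 hμ2 (by omega) h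
  · exact eq_zero_of_residue_at_one hμ0 hμ1 hμ2 (by omega) h
  · refine eq_zero_of_residue_at_one (neg_ne_zero.mpr hμ0) (fun h => hμ2 (neg_eq_iff_eq_neg.mp h))
      (fun h => hμ1 (neg_injective h)) (by omega) ?_
    rw [KovacicEq, poleProd_neg, RP_neg, residueSum_neg]
    exact h
  · exact eq_zero_of_residues_at_both hμ1 hμ2 (by omega) h
  · exact eq_zero_of_degree_three hμ0 hμ1 hμ2 (by omega) h

/-- Kovacic case 1 fails for the Zipoy-Voorhees NVE: for `p₀ = 1` and
`μ ∉ {0, 1, -1}` there is no solution of `ξ'' = r ξ` of the form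
`ξ = P e^{∫ω}` with `P` a nonzero polynomial and `ω = N/M` rational.
Substituting such `ξ` gives `P'' + 2ωP' + (ω' + ω² - r)P = 0`; clearing the
denominators `M²` and `4D₀` this is the polynomial identity below, which has
no solution with `P ≠ 0`, `M ≠ 0`. -/
theorem stmt13 (μ : ℂ) (hμ0 : μ ≠ 0) (hμ1 : μ ≠ 1) (hμ2 : μ ≠ -1) :
    ¬ ∃ P N M : Polynomial ℂ, P ≠ 0 ∧ M ≠ 0 ∧
      4 * D0 μ *
        (M ^ 2 * derivative (derivative P)
          + 2 * N * M * derivative P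
          + (derivative N * M - N * derivative M + N ^ 2) * P)
      = RP μ * M ^ 2 * P := by
  rintro ⟨P, N, M, hP, hM, h⟩
  obtain ⟨A, B, hAB, hB, h⟩ := exists_coprime_riccati hP hM h
  rw [D0_eq_poleProd_sq] at h
  obtain ⟨T, Q, hQ, hQS, h⟩ := exists_partial_fraction (poleProd_ne_zero hμ1 hμ2)
    (isCoprime_poleProd_RP hμ0 hμ1 hμ2) hAB hB h
  have hT := natDegree_le_four hQ h
  obtain ⟨e, he, hTe⟩ := exists_residueSum_eq hμ0 hμ1 hμ2 hT hQS h
  refine hQ (eq_zero_of_kovacicEq hμ0 hμ1 hμ2 he ?_ ?_)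
  · have h1 : 1 - μ ≠ 0 := sub_ne_zero.mpr hμ1.symm
    have h2 : 1 + μ ≠ 0 := fun h => hμ2 (by linear_combination h)
    have hinf := indicial_infinity hQ (natDegree_poleProd_le μ) hT
      (by have := natDegree_RP_le μ; omega) h
    have hT4 : 4 * T.coeff 4 = (e 0 + e 1 + e 2 + e 3 + e 4) * ((1 - μ) * (1 + μ)) := by
      rw [← coeff_residueSum_four, ← hTe, ← coeff_ofNat_mul]
    rw [coeff_poleProd_five] at hinf
    have hs := mul_ne_zero h1 h2
    rcases mul_eq_zero.mp hinf with hz | hz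
    · left
      have : ((1 - μ) * (1 + μ)) * (4 * Q.natDegree + (e 0 + e 1 + e 2 + e 3 + e 4)) = 0 := by
        linear_combination 4 * hz - hT4
      exact_mod_cast (mul_eq_zero.mp this).resolve_left hs
    · right
      have : ((1 - μ) * (1 + μ)) * (4 * Q.natDegree + (e 0 + e 1 + e 2 + e 3 + e 4) - 4) = 0 := by
        linear_combination 4 * hz - hT4
      exact_mod_cast sub_eq_zero.mp ((mul_eq_zero.mp this).resolve_left hs)
  · rw [← hTe, KovacicEq]
    rw [derivative_mul, derivative_ofNat]
    linear_combination 4 * h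
end
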